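/- Let a, b, c be nonnegative integers with a, c ≥ 1, and let j, k be integers with 1 ≤ j ≤ a and 1 ≤ k ≤ c. Consider the region ADJ(a,b,c)_{j,k} obtained from the hexagon H_{a,b,c} by removing two dents on adjacent sides of lengths a and c: the boundary unit triangle in position j along the side of length a and the boundary unit triangle in position k along the adjacent side of length c, both positions counted from the common vertex of the two sides, the two removed triangles having opposite orientations (one up-pointing and one down-pointing), so that the region is balanced. Then M(ADJ(a,b,c)_{j,k}) = [∏_{i=0}^{a−1} (c+i)_b/(1+i)_b] · 3F2[−a+j, b, −c+k; 1−a−c, 1+b; 1] · (1+b)_{a−j} (j)_{k−1} (1+c−k)_{k−1} / [(1)_{a−j} (1)_{k−1} (1+b+c−k)_{k−1}]. -/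

import Mathlib

/-- A unit triangle of the triangular lattice, encoded as `(x, y, ε)` where
`ε = true` means up-pointing and `ε = false` means down-pointing. -/
abbrev Tri : Type := ℤ × ℤ × Bool

/-- Two unit triangles are adjacent (i.e. together they form a lozenge) iff one of them is
the up-triangle at `(x,y)` and the other is one of the down-triangles at
`(x,y)`, `(x-1,y)`, `(x,y-1)`. -/
def Adj (s t : Tri) : Prop :=
  ∃ x y : ℤ,
    ({s, t} : Set Tri) = {(x, y, true), (x, y, false)} ∨
    ({s, t} : Set Tri) = {(x, y, true), (x - 1, y, false)} ∨
    ({s, t} : Set Tri) = {(x, y, true), (x, y - 1, false)}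

/-- `P` is a lozenge tiling of the region `R`: a partition of `R` into pairs of
adjacent unit triangles. -/
def IsLozengeTiling (R : Set Tri) (P : Set (Set Tri)) : Prop :=
  (∀ L ∈ P, ∃ s t : Tri, Adj s t ∧ L = {s, t}) ∧
  (∀ L ∈ P, L ⊆ R) ∧
  (∀ r ∈ R, ∃! L, L ∈ P ∧ r ∈ L)

/-- The number of lozenge tilings of the region `R`. -/
noncomputable def M (R : Set Tri) : ℕ :=
  Nat.card {P : Set (Set Tri) // IsLozengeTiling R P}

/-- The hexagonal region `H^k_{a,b,c}` on the triangular lattice, whose side lengths in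
clockwise order starting from the top side are `a, b+k, c, a+k, b, c+k`.
(Concretely: the unit triangles all of whose vertices `(x,y)` satisfy
`0 ≤ x ≤ a+b+k`, `0 ≤ y ≤ b+c+k`, `b ≤ x+y ≤ a+b+c+k`.) -/
def HexK (a b c k : ℕ) : Set Tri :=
  {t | 0 ≤ t.1 ∧ t.1 ≤ (a : ℤ) + b + k - 1 ∧ 0 ≤ t.2.1 ∧ t.2.1 ≤ (b : ℤ) + c + k - 1 ∧
    (if t.2.2 then (b : ℤ) ≤ t.1 + t.2.1 ∧ t.1 + t.2.1 ≤ (a : ℤ) + b + c + k - 1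
     else (b : ℤ) - 1 ≤ t.1 + t.2.1 ∧ t.1 + t.2.1 ≤ (a : ℤ) + b + c + k - 2)}

/-- The hexagonal region `H_{a,b,c}` whose side lengths in clockwise order starting from
the top side are `a, b, c, a, b, c`. -/
def Hex (a b c : ℕ) : Set Tri := HexK a b c 0

/-- The rising factorial (Pochhammer symbol) `(x)_n = x (x+1) ⋯ (x+n-1)`. -/
def rF (x : ℚ) (n : ℕ) : ℚ := ∏ t ∈ Finset.range n, (x + t)

/-- The hypergeometric series `pFq[tops; bots; 1] = Σ_{t ≥ 0} ∏(aᵢ)_t / (∏(bᵢ)_t · t!)`. -/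
noncomputable def hyp (tops bots : List ℚ) : ℚ :=
  ∑' t : ℕ, (tops.map (fun p => rF p t)).prod /
    ((bots.map (fun p => rF p t)).prod * (Nat.factorial t : ℚ))

theorem Adj.symm {s t : Tri} (h : Adj s t) : Adj t s := by
  obtain ⟨x, y, h⟩ := h
  exact ⟨x, y, by rwa [Set.pair_comm t s]⟩

theorem adj_up_iff (x y : ℤ) (t : Tri) :
    Adj (x, y, true) t ↔ t = (x, y, false) ∨ t = (x - 1, y, false) ∨ t = (x, y - 1, false) := by
  constructor
  · rintro ⟨x', y', h⟩
    simp only [Set.pair_eq_pair_iff, Prod.mk.injEq] at h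
    grind
  · intro h
    refine ⟨x, y, ?_⟩
    rcases h with rfl | rfl | rfl <;> simp

theorem adj_down_iff (x y : ℤ) (t : Tri) :
    Adj (x, y, false) t ↔ t = (x, y, true) ∨ t = (x + 1, y, true) ∨ t = (x, y + 1, true) := by
  constructor
  · rintro ⟨x', y', h⟩
    simp only [Set.pair_eq_pair_iff, Prod.mk.injEq] at h
    grind
  · rintro (rfl | rfl | rfl)
    · exact ⟨x, y, Or.inl (Set.pair_comm _ _)⟩
    · refine ⟨x + 1, y, Or.inr (Or.inl ?_)⟩
      rw [Set.pair_comm, add_sub_cancel_right]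
    · refine ⟨x, y + 1, Or.inr (Or.inr ?_)⟩
      rw [Set.pair_comm, add_sub_cancel_right]

theorem Adj.ne {s t : Tri} (h : Adj s t) : s ≠ t := by
  rintro rfl
  obtain ⟨x, y, ε⟩ := s
  cases ε
  · simp [adj_down_iff] at h
  · simp [adj_up_iff] at h

theorem IsLozengeTiling.eq_of_mem {R : Set Tri} {P : Set (Set Tri)} (h : IsLozengeTiling R P)
    {L L' : Set Tri} {r : Tri} (hL : L ∈ P) (hL' : L' ∈ P) (hr : r ∈ L) (hr' : r ∈ L') : L = L' :=
  (h.2.2 r (h.2.1 L hL hr)).unique ⟨hL, hr⟩ ⟨hL', hr'⟩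

theorem IsLozengeTiling.insert_pair {R : Set Tri} {P : Set (Set Tri)} {s t : Tri} (hs : s ∈ R)
    (ht : t ∈ R) (hst : Adj s t) (h : IsLozengeTiling (R \ {s, t}) P) :
    IsLozengeTiling R (insert {s, t} P) := by
  refine ⟨?_, ?_, ?_⟩
  · rintro L (rfl | hL)
    · exact ⟨s, t, hst, rfl⟩
    · exact h.1 L hL
  · rintro L (rfl | hL)
    · exact Set.pair_subset hs ht
    · exact (h.2.1 L hL).trans Set.sdiff_subset
  · intro r hr
    by_cases hrst : r ∈ ({s, t} : Set Tri)
    · refine ⟨{s, t}, ⟨Set.mem_insert _ _, hrst⟩, ?_⟩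
      rintro L ⟨rfl | hL, hrL⟩
      · rfl
      · exact absurd hrst (h.2.1 L hL hrL).2
    · obtain ⟨L, ⟨hL, hrL⟩, huniq⟩ := h.2.2 r ⟨hr, hrst⟩
      refine ⟨L, ⟨Set.mem_insert_of_mem _ hL, hrL⟩, ?_⟩
      rintro L' ⟨rfl | hL', hrL'⟩
      · exact absurd hrL' hrst
      · exact huniq L' ⟨hL', hrL'⟩

theorem IsLozengeTiling.remove_pair {R : Set Tri} {P : Set (Set Tri)} {s t : Tri}
    (h : IsLozengeTiling R P) (hst : {s, t} ∈ P) :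
    IsLozengeTiling (R \ {s, t}) (P \ {{s, t}}) := by
  refine ⟨fun L hL => h.1 L hL.1, ?_, ?_⟩
  · intro L hL r hr
    refine ⟨h.2.1 L hL.1 hr, fun hr' => hL.2 ?_⟩
    exact h.eq_of_mem hL.1 hst hr hr'
  · rintro r ⟨hr, hrst⟩
    obtain ⟨L, ⟨hL, hrL⟩, huniq⟩ := h.2.2 r hr
    refine ⟨L, ⟨⟨hL, ?_⟩, hrL⟩, fun L' hL' => huniq L' ⟨hL'.1.1, hL'.2⟩⟩
    rintro rfl
    exact hrst hrL

theorem IsLozengeTiling.pair_notMem {R : Set Tri} {P : Set (Set Tri)} {s t : Tri}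
    (h : IsLozengeTiling (R \ {s, t}) P) : {s, t} ∉ P := fun hmem =>
  (h.2.1 _ hmem (Set.mem_insert s {t})).2 (Set.mem_insert s {t})

theorem finite_tilings {R : Set Tri} (hR : R.Finite) :
    Finite {P : Set (Set Tri) // IsLozengeTiling R P} := by
  have : {P : Set (Set Tri) | IsLozengeTiling R P} ⊆ 𝒫 (𝒫 R) := fun P hP L hL => hP.2.1 L hL
  exact (hR.powerset.powerset.subset this).to_subtype

/-- Expansion of the number of tilings along a unit triangle of the region. -/
theorem M_eq_sum {R : Set Tri} (hR : R.Finite) {s : Tri} (hs : s ∈ R) (T : Finset Tri)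
    (hT : ∀ t, t ∈ T ↔ t ∈ R ∧ Adj s t) : M R = ∑ t ∈ T, M (R \ {s, t}) := by
  have hfin : ∀ t, Finite {P : Set (Set Tri) // IsLozengeTiling (R \ {s, t}) P} := fun t =>
    finite_tilings hR.sdiff
  let f : (Σ t : T, {P : Set (Set Tri) // IsLozengeTiling (R \ {s, t.1}) P}) →
      {P : Set (Set Tri) // IsLozengeTiling R P} := fun p =>
    ⟨insert {s, p.1.1} p.2.1,
      p.2.2.insert_pair hs ((hT _).1 p.1.2).1 ((hT _).1 p.1.2).2⟩
  have hf : Function.Bijective f := by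
    constructor
    · rintro ⟨⟨t, ht⟩, P, hP⟩ ⟨⟨t', ht'⟩, P', hP'⟩ h
      have h1 : insert {s, t} P = insert {s, t'} P' := congrArg Subtype.val h
      have htile := (f ⟨⟨t, ht⟩, P, hP⟩).2
      have h2 : ({s, t} : Set Tri) = {s, t'} :=
        htile.eq_of_mem (r := s) (Set.mem_insert _ _)
          (by change _ ∈ insert {s, t} P; rw [h1]; exact Set.mem_insert _ _) (by simp) (by simp)
      have h3 : t = t' := by
        have := ((hT _).1 ht).2.ne
        have h4 : t ∈ ({s, t'} : Set Tri) := h2 ▸ (by simp)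
        rcases h4 with h4 | h4
        · exact absurd h4.symm this
        · exact h4
      subst h3
      have h5 : P = P' := by
        have := congrArg (fun Q => Q \ {({s, t} : Set Tri)}) h1
        simpa [Set.insert_sdiff_of_mem, Set.sdiff_singleton_eq_self hP.pair_notMem,
          Set.sdiff_singleton_eq_self hP'.pair_notMem] using this
      subst h5
      rfl
    · rintro ⟨P, hP⟩
      obtain ⟨L, ⟨hL, hsL⟩, -⟩ := hP.2.2 s hs
      obtain ⟨t, ht, rfl⟩ : ∃ t, Adj s t ∧ L = {s, t} := by
        obtain ⟨u, v, huv, rfl⟩ := hP.1 L hL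
        rcases hsL with rfl | rfl
        · exact ⟨v, huv, rfl⟩
        · exact ⟨u, huv.symm, Set.pair_comm _ _⟩
      have htR : t ∈ R := hP.2.1 _ hL (by simp)
      refine ⟨⟨⟨t, (hT t).2 ⟨htR, ht⟩⟩, P \ {{s, t}}, hP.remove_pair hL⟩, ?_⟩
      apply Subtype.ext
      change insert {s, t} (P \ {{s, t}}) = P
      rw [Set.insert_sdiff_singleton, Set.insert_eq_of_mem hL]
  rw [M, ← Nat.card_congr (Equiv.ofBijective f hf), Nat.card_sigma]
  exact Finset.sum_coe_sort T fun t => M (R \ {s, t})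

theorem M_empty : M ∅ = 1 := by
  have : ∀ P : Set (Set Tri), IsLozengeTiling ∅ P ↔ P = ∅ := by
    intro P
    constructor
    · intro h
      refine Set.eq_empty_of_forall_notMem fun L hL => ?_
      obtain ⟨s, t, -, rfl⟩ := h.1 L hL
      exact h.2.1 _ hL (Set.mem_insert s {t})
    · rintro rfl
      exact ⟨by simp, by simp, by simp⟩
  simp [M, this]

theorem M_forced {R : Set Tri} (hR : R.Finite) {s t : Tri} (hs : s ∈ R) (ht : t ∈ R)
    (hst : Adj s t) (h : ∀ t' ∈ R, Adj s t' → t' = t) : M R = M (R \ {s, t}) := by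
  rw [M_eq_sum hR hs {t} (fun t' => ?_)]
  · simp
  · rw [Finset.mem_singleton]
    exact ⟨fun e => e ▸ ⟨ht, hst⟩, fun e => h t' e.1 e.2⟩

theorem M_forced_row {R : Set Tri} (hR : R.Finite) (y : ℤ) (hup : ∀ x, (x, y, true) ∉ R)
    (S : Finset ℤ) (hS : ∀ x ∈ S, (x, y, false) ∈ R ∧ (x, y + 1, true) ∈ R) :
    M R = M (R \ {t | ∃ x ∈ S, t = (x, y, false) ∨ t = (x, y + 1, true)}) := by
  induction S using Finset.induction_on with
  | empty => simp
  | insert x S hx ih =>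
    rw [ih fun x' hx' => hS x' (Finset.mem_insert_of_mem hx')]
    obtain ⟨h1, h2⟩ := hS x (Finset.mem_insert_self _ _)
    rw [M_forced hR.sdiff (s := (x, y, false)) (t := (x, y + 1, true))]
    · congr 1
      ext t
      simp only [Set.mem_sdiff, Set.mem_ofPred_eq, Set.mem_insert_iff, Set.mem_singleton_iff,
        Finset.mem_insert]
      grind
    · refine ⟨h1, ?_⟩
      simp only [Set.mem_ofPred_eq, Prod.mk.injEq]
      grind
    · refine ⟨h2, ?_⟩
      simp only [Set.mem_ofPred_eq, Prod.mk.injEq]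
      grind
    · exact (adj_down_iff _ _ _).2 (Or.inr (Or.inr rfl))
    · rintro t' ⟨ht', -⟩ hadj
      rcases (adj_down_iff _ _ _).1 hadj with rfl | rfl | rfl
      · exact absurd ht' (hup _)
      · exact absurd ht' (hup _)
      · rfl

theorem mem_hex_up {a b c : ℕ} {x y : ℤ} : (x, y, true) ∈ Hex a b c ↔
    0 ≤ x ∧ x ≤ a + b - 1 ∧ 0 ≤ y ∧ y ≤ b + c - 1 ∧ b ≤ x + y ∧ x + y ≤ a + b + c - 1 := by
  simp [Hex, HexK]

theorem mem_hex_down {a b c : ℕ} {x y : ℤ} : (x, y, false) ∈ Hex a b c ↔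
    0 ≤ x ∧ x ≤ a + b - 1 ∧ 0 ≤ y ∧ y ≤ b + c - 1 ∧ b - 1 ≤ x + y ∧
      x + y ≤ a + b + c - 2 := by
  simp [Hex, HexK]

theorem finite_hex (a b c : ℕ) : (Hex a b c).Finite := by
  refine ((Set.finite_Icc (0 : ℤ) (a + b - 1)).prod
    ((Set.finite_Icc (0 : ℤ) (b + c - 1)).prod (Set.finite_univ (α := Bool)))).subset ?_
  rintro ⟨x, y, ε⟩ h
  cases ε
  · rw [mem_hex_down] at h
    exact ⟨Set.mem_Icc.2 ⟨h.1, h.2.1⟩, Set.mem_Icc.2 ⟨h.2.2.1, h.2.2.2.1⟩, trivial⟩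
  · rw [mem_hex_up] at h
    exact ⟨Set.mem_Icc.2 ⟨h.1, h.2.1⟩, Set.mem_Icc.2 ⟨h.2.2.1, h.2.2.2.1⟩, trivial⟩

/-- The number of lattice paths with `h` steps, `z` of which go to the left. -/
def pathCount (h z : ℤ) : ℤ := if 0 ≤ z then (h.toNat.choose z.toNat : ℤ) else 0

theorem pathCount_of_neg {h z : ℤ} (hz : z < 0) : pathCount h z = 0 := by
  simp [pathCount, hz]

theorem pathCount_of_lt {h z : ℤ} (hh : 0 ≤ h) (hz : h < z) : pathCount h z = 0 := by
  rw [pathCount, if_pos (by omega), Nat.choose_eq_zero_of_lt (by omega), Nat.cast_zero]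

theorem pathCount_natCast (h z : ℕ) : pathCount h z = h.choose z := by
  simp [pathCount]

theorem pathCount_zero (z : ℤ) : pathCount 0 z = if z = 0 then 1 else 0 := by
  rcases lt_trichotomy z 0 with h | rfl | h
  · rw [pathCount_of_neg h, if_neg h.ne]
  · simp [pathCount]
  · rw [pathCount_of_lt le_rfl h, if_neg h.ne']

theorem pathCount_pascal {h : ℤ} (hh : 0 ≤ h) (z : ℤ) :
    pathCount (h + 1) z = pathCount h z + pathCount h (z - 1) := by
  lift h to ℕ using hh
  rcases lt_trichotomy z 0 with hz | rfl | hz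
  · rw [pathCount_of_neg hz, pathCount_of_neg hz, pathCount_of_neg (by omega), add_zero]
  · simp [pathCount]
  · obtain ⟨m, rfl⟩ : ∃ m : ℕ, z = (m + 1 : ℕ) := ⟨(z - 1).toNat, by omega⟩
    have h1 : ((m + 1 : ℕ) : ℤ) - 1 = (m : ℕ) := by push_cast; ring
    rw [h1, ← Nat.cast_succ, pathCount_natCast, pathCount_natCast, pathCount_natCast,
      Nat.choose_succ_succ]
    push_cast
    ring

/-- The part of the hexagon above height `y` left to be tiled when the paths of lozenges
crossing horizontal edges have reached the horizontal edges listed by `v`. -/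
def pathRegion (a b c : ℕ) {m : ℕ} (y : ℤ) (v : Fin m → ℤ × ℤ) : Set Tri :=
  {t | t ∈ Hex a b c ∧ y ≤ t.2.1 ∧ (t.2.2 = true → t.2.1 = y → ∃ i, v i = (t.1, y)) ∧
    (t.2.2 = false → ∀ i, v i ≠ (t.1, t.2.1 + 1))}

/-- The determinant counting the families of nonintersecting paths from `v` to the top side. -/
def pathMatrix (n b c : ℕ) (v : Fin (n + 1) → ℤ × ℤ) : Matrix (Fin (n + 1)) (Fin (n + 1)) ℤ :=
  Matrix.of fun i j => pathCount (b + c - (v i).2) ((v i).1 - (n - j))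

/-- The positions `v` are reachable when the rows below height `y` are already tiled and the
row at height `y` is being tiled from left to right; `v 0` is allowed to be far above. -/
structure Reachable (n b c : ℕ) (y : ℤ) (v : Fin (n + 1) → ℤ × ℤ) : Prop where
  x_nonneg : ∀ i, 0 ≤ (v i).1
  x_le : ∀ i, (v i).1 ≤ n + b
  le_sum : ∀ i, b ≤ (v i).1 + (v i).2
  sum_le : ∀ i, (v i).1 + (v i).2 ≤ n + b + c
  height_le : ∀ i, (v i).2 ≤ b + c
  le_height : ∀ i, y ≤ (v i).2
  height_le_succ : ∀ i, i ≠ 0 → (v i).2 ≤ y + 1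
  order : ∀ i j, i < j →
    (v j).1 < (v i).1 ∨ (i = 0 ∧ (v j).1 = (v i).1 ∧ (v j).2 < (v i).2)

theorem Reachable.injective {n b c : ℕ} {y : ℤ} {v : Fin (n + 1) → ℤ × ℤ}
    (hv : Reachable n b c y v) {i j : Fin (n + 1)} (h : v i = v j) : i = j := by
  rcases lt_trichotomy i j with hij | rfl | hij
  · have := hv.order i j hij
    rw [h] at this
    omega
  · rfl
  · have := hv.order j i hij
    rw [h] at this
    omega

theorem Reachable.eq_of_top {n b c : ℕ} {y : ℤ} {v : Fin (n + 1) → ℤ × ℤ}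
    (hv : Reachable n b c y v) (htop : ∀ i, (v i).2 = b + c) (i : Fin (n + 1)) :
    v i = ((n : ℤ) - (i : ℕ), (b + c : ℤ)) := by
  have hanti : ∀ i j, i < j → (v j).1 < (v i).1 := by
    intro i j hij
    have h1 := hv.order i j hij
    rw [htop i, htop j] at h1
    omega
  have hlow : ∀ k : ℕ, ∀ i : Fin (n + 1), (i : ℕ) + k = n → (k : ℤ) ≤ (v i).1 := by
    intro k
    induction k with
    | zero => intro i _; simpa using hv.x_nonneg i
    | succ k ih =>
      intro i hi
      have h1 := ih ⟨i + 1, by omega⟩ (by simp; omega)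
      have h2 := hanti i ⟨i + 1, by omega⟩ (by simp [Fin.lt_def])
      push_cast
      omega
  have hupp : ∀ k : ℕ, ∀ i : Fin (n + 1), (i : ℕ) = k → (v i).1 ≤ n - k := by
    intro k
    induction k with
    | zero =>
      intro i _
      have := hv.sum_le i
      rw [htop i] at this
      push_cast
      omega
    | succ k ih =>
      intro i hi
      have h1 := ih ⟨k, by omega⟩ rfl
      have h2 := hanti ⟨k, by omega⟩ i (by simp [Fin.lt_def]; omega)
      push_cast
      omega
  have h1 := hlow (n - i) i (by omega)
  have h2 := hupp i i rfl
  rw [Nat.cast_sub (by omega)] at h1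
  exact Prod.ext (by simp only; omega) (htop i)

theorem Reachable.update {n b c : ℕ} {y : ℤ} {v : Fin (n + 1) → ℤ × ℤ}
    (hv : Reachable n b c y v) {i : Fin (n + 1)} (hi : (v i).2 = y)
    (hmax : ∀ j, i < j → (v j).2 ≠ y) {x : ℤ} (hx : x = (v i).1 ∨ x = (v i).1 - 1)
    (hmem : (x, y, false) ∈ Hex (n + 1) b c) (hfree : ∀ j, v j ≠ (x, y + 1)) :
    Reachable n b c y (Function.update v i (x, y + 1)) := by
  rw [mem_hex_down] at hmem
  push_cast at hmem
  have key : ∀ (p : ℤ × ℤ → Prop), p (x, y + 1) → (∀ j, p (v j)) →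
      ∀ j, p (Function.update v i (x, y + 1) j) := by
    intro p h1 h2 j
    rcases eq_or_ne j i with rfl | hj
    · simpa using h1
    · simpa [hj] using h2 j
  refine ⟨key (fun p => 0 ≤ p.1) (by simp only; omega) hv.x_nonneg,
    key (fun p => p.1 ≤ n + b) (by simp only; omega) hv.x_le,
    key (fun p => b ≤ p.1 + p.2) (by simp only; omega) hv.le_sum,
    key (fun p => p.1 + p.2 ≤ n + b + c) (by simp only; omega) hv.sum_le,
    key (fun p => p.2 ≤ b + c) (by simp only; omega) hv.height_le,
    key (fun p => y ≤ p.2) (by simp only; omega) hv.le_height, ?_, ?_⟩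
  · intro j hj0
    rcases eq_or_ne j i with rfl | hj
    · simp
    · simpa [hj] using hv.height_le_succ j hj0
  · intro j l hjl
    have h0 := hv.order j l hjl
    rcases eq_or_ne j i with rfl | hj
    · have hl : l ≠ j := hjl.ne'
      simp only [Function.update_self, Function.update_of_ne hl]
      have h1 := hmax l hjl
      have h2 := hv.le_height l
      have h3 := hv.height_le_succ l (by rintro rfl; simp at hjl)
      have h4 : (v l).1 ≠ x := by
        intro h4
        exact hfree l (Prod.ext h4 (by simp only; omega))
      omega
    · rcases eq_or_ne l i with rfl | hl
      · simp only [Function.update_self, Function.update_of_ne hj]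
        have h4 : (v j).2 ≠ y + 1 ∨ (v j).1 ≠ x := by
          by_contra! h4
          exact hfree j (Prod.ext h4.2 h4.1)
        omega
      · simpa only [Function.update_of_ne hj, Function.update_of_ne hl] using h0

theorem Reachable.mem_up {n b c : ℕ} {y : ℤ} {v : Fin (n + 1) → ℤ × ℤ}
    (hv : Reachable n b c y v) (hy0 : 0 ≤ y) (hy : y < b + c) {i : Fin (n + 1)}
    (hi : (v i).2 = y) : ((v i).1, y, true) ∈ pathRegion (n + 1) b c y v := by
  refine ⟨?_, le_rfl, fun _ _ => ⟨i, Prod.ext rfl hi⟩, by simp⟩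
  rw [mem_hex_up]
  have h1 := hv.x_nonneg i
  have h2 := hv.x_le i
  have h3 := hv.le_sum i
  have h4 := hv.sum_le i
  push_cast
  omega

theorem Reachable.remove_eq {n b c : ℕ} {y : ℤ} {v : Fin (n + 1) → ℤ × ℤ}
    (hv : Reachable n b c y v) {i : Fin (n + 1)} (hi : (v i).2 = y) (x : ℤ) :
    pathRegion (n + 1) b c y v \ {((v i).1, y, true), (x, y, false)} =
      pathRegion (n + 1) b c y (Function.update v i (x, y + 1)) := by
  have hinj : ∀ j, j ≠ i → v j ≠ v i := fun j hj h => hj (hv.injective h)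
  have hvi : v i = ((v i).1, y) := Prod.ext rfl hi
  have hup : ∀ p : ℤ × ℤ, (∃ j, Function.update v i (x, y + 1) j = p) ↔
      p = (x, y + 1) ∨ ((∃ j, v j = p) ∧ p ≠ v i) := by
    intro p
    constructor
    · rintro ⟨j, rfl⟩
      rcases eq_or_ne j i with rfl | hj
      · simp
      · rw [Function.update_of_ne hj]
        exact Or.inr ⟨⟨j, rfl⟩, hinj j hj⟩
    · rintro (rfl | ⟨⟨j, rfl⟩, hj⟩)
      · exact ⟨i, by simp⟩
      · refine ⟨j, Function.update_of_ne ?_ _ _⟩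
        rintro rfl
        exact hj rfl
  ext ⟨x', y', ε⟩
  cases ε
  · have h1 := hup (x', y' + 1)
    simp only [pathRegion, Set.mem_sdiff, Set.mem_ofPred_eq, Set.mem_insert_iff,
      Set.mem_singleton_iff, Prod.mk.injEq, Bool.false_eq_true, false_imp_iff,
      true_and, and_true, and_false, false_or, ne_eq, ← not_exists, h1]
    rw [hvi]
    simp only [Prod.mk.injEq]
    grind
  · have h1 := hup (x', y)
    simp only [pathRegion, Set.mem_sdiff, Set.mem_ofPred_eq, Set.mem_insert_iff,
      Set.mem_singleton_iff, Prod.mk.injEq, Bool.true_eq_false, false_imp_iff, true_imp_iff,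
      and_true, and_false, or_false, ne_eq, h1]
    rw [hvi]
    simp only [Prod.mk.injEq]
    grind

theorem Reachable.advance_eq {n b c : ℕ} {y : ℤ} {v : Fin (n + 1) → ℤ × ℤ}
    (hv : Reachable n b c y v) (hy0 : 0 ≤ y) (hy : y < b + c) (hne : ∀ i, (v i).2 ≠ y) :
    M (pathRegion (n + 1) b c y v) = M (pathRegion (n + 1) b c (y + 1) v) := by
  classical
  have hfin : (pathRegion (n + 1) b c y v).Finite := (finite_hex _ _ _).subset fun t ht => ht.1
  have hup : ∀ x, (x, y, true) ∉ pathRegion (n + 1) b c y v := by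
    rintro x ⟨-, -, h, -⟩
    obtain ⟨i, hi⟩ := h rfl rfl
    exact hne i (by rw [hi])
  have htop : y + 1 = b + c → ∀ x, (x, y, false) ∈ Hex (n + 1) b c → ∃ i, v i = (x, y + 1) := by
    intro h x hx
    have h1 : ∀ i, (v i).2 = b + c := fun i => by
      have := hv.height_le i
      have := hv.le_height i
      have := hne i
      omega
    rw [mem_hex_down] at hx
    push_cast at hx
    refine ⟨⟨(n - x).toNat, by omega⟩, ?_⟩
    rw [hv.eq_of_top h1]
    exact Prod.ext (by simp only; omega) h.symm
  rw [M_forced_row hfin y hup ((Finset.Icc 0 ((n : ℤ) + b)).filter fun x =>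
    (x, y, false) ∈ Hex (n + 1) b c ∧ ∀ i, v i ≠ (x, y + 1))]
  · congr 1
    ext ⟨x', y', ε⟩
    have hbd : (x', y, false) ∈ Hex (n + 1) b c → 0 ≤ x' ∧ x' ≤ n + b := by
      rw [mem_hex_down]
      push_cast
      omega
    have hlast : (x', y + 1, true) ∈ Hex (n + 1) b c → (x', y, false) ∈ Hex (n + 1) b c := by
      rw [mem_hex_down, mem_hex_up]
      push_cast
      omega
    cases ε
    · simp only [pathRegion, Set.mem_sdiff, Set.mem_ofPred_eq, Prod.mk.injEq, Bool.false_eq_true,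
        false_imp_iff, true_imp_iff, true_and, and_true, and_false, or_false, Finset.mem_filter,
        Finset.mem_Icc]
      grind
    · have hup' := hup x'
      simp only [pathRegion, Set.mem_ofPred_eq, Bool.true_eq_false,
        false_imp_iff, true_imp_iff, and_true, le_refl, true_and] at hup'
      simp only [pathRegion, Set.mem_sdiff, Set.mem_ofPred_eq, Prod.mk.injEq, Bool.true_eq_false,
        false_imp_iff, true_imp_iff, and_true, and_false, false_or, Finset.mem_filter,
        Finset.mem_Icc]
      grind
  · intro x hx
    rw [Finset.mem_filter] at hx
    obtain ⟨-, hx, hfree⟩ := hx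
    refine ⟨⟨hx, le_rfl, by simp, fun _ => hfree⟩, ⟨?_, by simp, ?_, by simp⟩⟩
    · have : y + 1 ≠ b + c := fun h => by
        obtain ⟨i, hi⟩ := htop h x hx
        exact hfree i hi
      rw [mem_hex_down] at hx
      rw [mem_hex_up]
      omega
    · simp

theorem Reachable.det_update {n b c : ℕ} {y : ℤ} {v : Fin (n + 1) → ℤ × ℤ}
    (hy : y < b + c) {i : Fin (n + 1)} (hi : (v i).2 = y) :
    (pathMatrix n b c v).det = (pathMatrix n b c (Function.update v i ((v i).1, y + 1))).det +
      (pathMatrix n b c (Function.update v i ((v i).1 - 1, y + 1))).det := by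
  have hrow : ∀ x : ℤ, pathMatrix n b c (Function.update v i (x, y + 1)) =
      (pathMatrix n b c v).updateRow i fun j => pathCount (b + c - (y + 1)) (x - (n - j)) := by
    intro x
    ext k j
    rcases eq_or_ne k i with rfl | hk
    · simp [pathMatrix]
    · simp [pathMatrix, hk]
  rw [hrow, hrow, ← Matrix.det_updateRow_add]
  congr 1
  ext k j
  rcases eq_or_ne k i with rfl | hk
  · have := pathCount_pascal (h := b + c - (y + 1)) (by omega) ((v k).1 - (n - j))
    simp only [pathMatrix, Matrix.of_apply, Matrix.updateRow_self, Pi.add_apply, hi]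
    convert this using 2
    · ring
    · congr 1
      ring
  · simp [pathMatrix, hk]

open Classical in
theorem Reachable.M_update {n b c : ℕ} {y : ℤ} {v : Fin (n + 1) → ℤ × ℤ}
    (hv : Reachable n b c y v) (hy0 : 0 ≤ y) (hy : y < b + c) {i : Fin (n + 1)}
    (hi : (v i).2 = y) (hmax : ∀ j, i < j → (v j).2 ≠ y)
    (ih : ∀ w, Reachable n b c y w → (∑ j, (w j).2 = ∑ j, (v j).2 + 1) →
      (M (pathRegion (n + 1) b c y w) : ℤ) = (pathMatrix n b c w).det)
    {x : ℤ} (hx : x = (v i).1 ∨ x = (v i).1 - 1) :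
    ((if (x, y, false) ∈ pathRegion (n + 1) b c y v then
      M (pathRegion (n + 1) b c y v \ {((v i).1, y, true), (x, y, false)}) else 0 : ℕ) : ℤ) =
      (pathMatrix n b c (Function.update v i (x, y + 1))).det := by
  split_ifs with hmem
  · have hmem1 := hmem.1
    have hmem2 := hmem.2.2.2 rfl
    rw [hv.remove_eq hi]
    refine ih _ (hv.update hi hmax hx hmem1 hmem2) ?_
    have h1 := Finset.sum_erase_add Finset.univ
      (fun j => (Function.update v i (x, y + 1) j).2) (Finset.mem_univ i)
    have h2 := Finset.sum_erase_add Finset.univ (fun j => (v j).2) (Finset.mem_univ i)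
    have h3 : ∑ j ∈ Finset.univ.erase i, (Function.update v i (x, y + 1) j).2 =
        ∑ j ∈ Finset.univ.erase i, (v j).2 :=
      Finset.sum_congr rfl fun j hj => by
        rw [Function.update_of_ne (Finset.ne_of_mem_erase hj)]
    simp only [Function.update_self] at h1
    omega
  · symm
    by_cases hhex : (x, y, false) ∈ Hex (n + 1) b c
    · obtain ⟨j, hj⟩ : ∃ j, v j = (x, y + 1) := by
        by_contra! h
        exact hmem ⟨hhex, le_rfl, by simp, fun _ => h⟩
      have hji : j ≠ i := by
        rintro rfl
        rw [hj] at hi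
        simp at hi
      refine Matrix.det_zero_of_row_eq hji ?_
      ext l
      simp [pathMatrix, hji, hj]
    · refine Matrix.det_eq_zero_of_row_eq_zero i fun j => ?_
      simp only [pathMatrix, Matrix.of_apply, Function.update_self]
      have h1 := hv.x_nonneg i
      have h2 := hv.x_le i
      have h3 := hv.le_sum i
      have h4 := hv.sum_le i
      have h5 := j.2
      rw [mem_hex_down] at hhex
      push_cast at hhex
      by_cases h6 : x < 0
      · exact pathCount_of_neg (by omega)
      · exact pathCount_of_lt (by omega) (by omega)

theorem Reachable.M_eq_det_aux {n b c : ℕ} (N : ℕ) : ∀ (y : ℤ) (v : Fin (n + 1) → ℤ × ℤ),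
    Reachable n b c y v → 0 ≤ y → y ≤ b + c → (∑ j, (v j).2) + N + y = (n + 2) * (b + c) →
    (M (pathRegion (n + 1) b c y v) : ℤ) = (pathMatrix n b c v).det := by
  classical
  have hsum : ∀ (y : ℤ) (v : Fin (n + 1) → ℤ × ℤ), Reachable n b c y v → y ≤ b + c →
      (∑ j, (v j).2) + y ≤ (n + 2) * (b + c) ∧
      ((∑ j, (v j).2) + y = (n + 2) * (b + c) → y = b + c) := by
    intro y v hv hy
    have h := Finset.sum_le_card_nsmul Finset.univ (fun j => (v j).2) (b + c)
      fun j _ => hv.height_le j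
    simp at h
    constructor
    · nlinarith
    · intro h'
      nlinarith
  induction N with
  | zero =>
    intro y v hv hy0 hy hN
    have hyt := (hsum y v hv hy).2 (by simpa using hN)
    have htop : ∀ i, (v i).2 = b + c := fun i => by
      have h1 := hv.height_le i
      have h2 := hv.le_height i
      omega
    have hempty : pathRegion (n + 1) b c y v = ∅ := by
      refine Set.eq_empty_of_forall_notMem ?_
      rintro ⟨x', y', ε⟩ ⟨h1, h2, -⟩
      simp only at h2
      cases ε
      · rw [mem_hex_down] at h1
        omega
      · rw [mem_hex_up] at h1
        omega
    have hone : pathMatrix n b c v = 1 := by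
      ext i j
      simp only [pathMatrix, Matrix.of_apply, hv.eq_of_top htop, sub_self, pathCount_zero,
        Matrix.one_apply, Fin.ext_iff]
      congr 1
      rw [eq_iff_iff]
      omega
    rw [hempty, hone, M_empty, Matrix.det_one, Nat.cast_one]
  | succ N ih =>
    intro y v hv hy0 hy hN
    have hylt : y < b + c := by
      refine lt_of_le_of_ne hy fun h => ?_
      have htop : ∀ i, (v i).2 = b + c := fun i => by
        have h1 := hv.height_le i
        have h2 := hv.le_height i
        omega
      simp only [htop, Finset.sum_const, Finset.card_univ, Fintype.card_fin, nsmul_eq_mul] at hN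
      push_cast at hN
      nlinarith
    by_cases hex : ∃ i, (v i).2 = y
    · obtain ⟨i, hi, hmax⟩ : ∃ i, (v i).2 = y ∧ ∀ j, i < j → (v j).2 ≠ y := by
        obtain ⟨i, hi⟩ := hex
        have hne : (Finset.univ.filter fun i => (v i).2 = y).Nonempty := ⟨i, by simp [hi]⟩
        refine ⟨_, (Finset.mem_filter.1 (Finset.max'_mem _ hne)).2, fun j hj hjy => ?_⟩
        exact absurd (Finset.le_max' _ j (by simp [hjy])) (not_le.2 hj)
      have ih' : ∀ w, Reachable n b c y w → (∑ j, (w j).2 = ∑ j, (v j).2 + 1) →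
          (M (pathRegion (n + 1) b c y w) : ℤ) = (pathMatrix n b c w).det := by
        intro w hw hsumw
        refine ih y w hw hy0 hy ?_
        rw [hsumw, ← hN]
        push_cast
        ring
      have hfin : (pathRegion (n + 1) b c y v).Finite :=
        (finite_hex _ _ _).subset fun t ht => ht.1
      rw [M_eq_sum hfin (hv.mem_up hy0 hylt hi)
        (({((v i).1, y, false), ((v i).1 - 1, y, false)} : Finset Tri).filter
          (· ∈ pathRegion (n + 1) b c y v)), Finset.sum_filter, Finset.sum_pair (by simp [eq_comm (a := (v i).1)]),
        Reachable.det_update hylt hi, Nat.cast_add,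
        hv.M_update hy0 hylt hi hmax ih' (Or.inl rfl),
        hv.M_update hy0 hylt hi hmax ih' (Or.inr rfl)]
      intro t
      rw [adj_up_iff, Finset.mem_filter, Finset.mem_insert, Finset.mem_singleton]
      have hlow : ∀ x, (x, y - 1, false) ∉ pathRegion (n + 1) b c y v := by
        rintro x ⟨-, h, -⟩
        simp at h
      grind
    · push Not at hex
      rw [hv.advance_eq hy0 hylt hex]
      refine ih (y + 1) v ?_ (by omega) (by omega) ?_
      · exact { hv with
          le_height := fun i => by
            have h1 := hv.le_height i
            have h2 := hex i
            omega
          height_le_succ := fun i hi => by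
            have := hv.height_le_succ i hi
            omega }
      · rw [← hN]
        push_cast
        ring

theorem Reachable.M_eq_det {n b c : ℕ} {y : ℤ} {v : Fin (n + 1) → ℤ × ℤ}
    (hv : Reachable n b c y v) (hy0 : 0 ≤ y) (hy : y ≤ b + c) :
    (M (pathRegion (n + 1) b c y v) : ℤ) = (pathMatrix n b c v).det := by
  have h := Finset.sum_le_card_nsmul Finset.univ (fun j => (v j).2) (b + c)
    fun j _ => hv.height_le j
  simp only [Finset.card_univ, Fintype.card_fin, nsmul_eq_mul] at h
  push_cast at h
  refine Reachable.M_eq_det_aux ((n + 2) * (b + c) - (∑ j, (v j).2) - y).toNat y v hv hy0 hy ?_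
  rw [Int.toNat_of_nonneg (by nlinarith)]
  ring

open Nat in
theorem sum_choose_mul_descFactorial_eq_zero {N U p q : ℕ} (V : ℕ) (hU : N ≤ U)
    (hpq : p + q < N) : ∑ r ∈ Finset.range (N + 1), (-1 : ℚ) ^ r * N.choose r *
      ((U - r).descFactorial p * (V + r).descFactorial q) = 0 := by
  let f : Polynomial ℚ := (descPochhammer ℚ p).comp (Polynomial.C (U : ℚ) - Polynomial.X) *
    (descPochhammer ℚ q).comp (Polynomial.X + Polynomial.C (V : ℚ))
  have hdeg : f.natDegree < N := by
    refine lt_of_le_of_lt Polynomial.natDegree_mul_le ?_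
    rw [Polynomial.natDegree_comp, Polynomial.natDegree_comp, descPochhammer_natDegree,
      descPochhammer_natDegree, Polynomial.natDegree_X_add_C,
      ← neg_sub, Polynomial.natDegree_neg, Polynomial.natDegree_X_sub_C]
    simpa using hpq
  have h := congrFun (Polynomial.fwdDiff_iter_eq_zero_of_degree_lt hdeg) 0
  rw [fwdDiff_iter_eq_sum_shift] at h
  simp only [Pi.zero_apply] at h
  have h2 : (-1 : ℚ) ^ N * ∑ r ∈ Finset.range (N + 1), (-1 : ℚ) ^ r * N.choose r *
      ((U - r).descFactorial p * (V + r).descFactorial q) = 0 := by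
    rw [← h, Finset.mul_sum]
    refine Finset.sum_congr rfl fun r hr => ?_
    have hrN : r ≤ N := by simpa [Nat.lt_succ_iff] using hr
    have h1 : f.eval (0 + r • (1 : ℚ)) =
        (U - r).descFactorial p * (V + r).descFactorial q := by
      simp only [f, Polynomial.eval_mul, Polynomial.eval_comp, Polynomial.eval_sub,
        Polynomial.eval_add, Polynomial.eval_X, Polynomial.eval_C]
      rw [← descPochhammer_eval_eq_descFactorial, ← descPochhammer_eval_eq_descFactorial,
        Nat.cast_sub (hrN.trans hU)]
      simp [add_comm]
    rw [h1, zsmul_eq_mul]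
    push_cast
    obtain ⟨d, rfl⟩ := Nat.exists_eq_add_of_le hrN
    rw [Nat.add_sub_cancel_left, pow_add]
    have : (-1 : ℚ) ^ r * (-1 : ℚ) ^ r = 1 := by rw [← mul_pow]; simp
    linear_combination ((-1 : ℚ) ^ d * (r + d).choose r *
      ((U - r).descFactorial p * (V + r).descFactorial q)) * this
  exact (mul_eq_zero.1 h2).resolve_left (by simp)

open Nat in
theorem factorial_mul_pathCount {u v p q h : ℕ} {z : ℤ} (hz : z = u - p) (hhz : h - z = v - q) :
    (u ! * v ! * pathCount h z : ℤ) = h ! * (u.descFactorial p * v.descFactorial q) := by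
  by_cases h1 : u < p
  · rw [Nat.descFactorial_of_lt h1, pathCount_of_neg (by omega)]
    simp
  by_cases h2 : v < q
  · rw [Nat.descFactorial_of_lt h2, pathCount_of_lt (by omega) (by omega)]
    simp
  push Not at h1 h2
  lift z to ℕ using by omega
  have h3 : z = u - p := by omega
  have h4 : h - z = v - q := by omega
  rw [pathCount_natCast, ← Nat.factorial_mul_descFactorial h1,
    ← Nat.factorial_mul_descFactorial h2, ← Nat.choose_mul_factorial_mul_factorial
      (show z ≤ h by omega), h4, ← h3]
  push_cast
  ring

/-- The factor `(b)_t / (1 + b)_t`. -/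
def pochRatio (b t : ℕ) : ℚ := if t = 0 then 1 else (b : ℚ) / (b + t)

theorem pochRatio_mul (b t : ℕ) : pochRatio b t * (b + t) = b := by
  unfold pochRatio
  split_ifs with h
  · simp [h]
  · have : (b + t : ℚ) ≠ 0 := by positivity
    field_simp

open Nat in
/-- The Chu-Vandermonde sum, up to normalization. -/
def vandermondeSum (n m L : ℕ) : ℚ := ∑ t ∈ Finset.range (n + 1),
  (-1) ^ t * (L - t)! * n.choose t * (m.choose t * t !)

open Nat in
/-- The hypergeometric sum with parameters `[-n, b, -m; -L, 1 + b]` at `1`, multiplied by `L!`. -/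
def saalschutzSum (b n m L : ℕ) : ℚ := ∑ t ∈ Finset.range (n + 1),
  (-1) ^ t * pochRatio b t * (L - t)! * n.choose t * (m.choose t * t !)

theorem choose_succ_mul_factorial (m t : ℕ) :
    ((m.choose (t + 1) * (t + 1).factorial : ℕ) : ℚ) = m * ((m - 1).choose t * t.factorial) := by
  cases m with
  | zero => simp
  | succ m =>
    have h := Nat.add_one_mul_choose_eq m t
    rw [Nat.factorial_succ, Nat.add_sub_cancel, ← mul_assoc, ← h]
    push_cast
    ring

open Nat in
theorem vandermondeSum_succ (n m L : ℕ) : vandermondeSum (n + 1) m L =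
    vandermondeSum n m L - m * vandermondeSum n (m - 1) (L - 1) := by
  unfold vandermondeSum
  have hlast : ∑ t ∈ Finset.range (n + 1), (-1 : ℚ) ^ (t + 1) * (L - (t + 1))! *
      n.choose (t + 1) * (m.choose (t + 1) * (t + 1)!) =
      ∑ t ∈ Finset.range n, (-1 : ℚ) ^ (t + 1) * (L - (t + 1))! *
      n.choose (t + 1) * (m.choose (t + 1) * (t + 1)!) := by
    rw [Finset.sum_range_succ]
    simp
  rw [Finset.sum_range_succ' _ n, ← hlast, Finset.sum_range_succ' _ (n + 1), Finset.mul_sum,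
    add_sub_right_comm, ← Finset.sum_sub_distrib]
  congr 1
  · refine Finset.sum_congr rfl fun t _ => ?_
    have h := choose_succ_mul_factorial m t
    push_cast at h
    rw [h, Nat.choose_succ_succ, show L - 1 - t = L - (t + 1) by omega]
    push_cast
    ring
  · simp

open Nat in
theorem vandermondeSum_eq (n m d : ℕ) :
    vandermondeSum n m (n + m + d) * d ! = (n + d)! * (m + d)! := by
  induction n generalizing m d with
  | zero => simp [vandermondeSum, mul_comm]
  | succ n ih =>
    rw [vandermondeSum_succ]
    have h1 := ih m (d + 1)
    rw [show n + m + (d + 1) = n + 1 + m + d by ring, show n + (d + 1) = n + 1 + d by ring] at h1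
    have hd : ((d + 1)! : ℚ) = (d + 1) * d ! := by rw [Nat.factorial_succ]; push_cast; ring
    have hd0 : (d + 1 : ℚ) ≠ 0 := by positivity
    have h3 : (m + (d + 1))! = (m + d + 1) * (m + d)! := by
      rw [← add_assoc, Nat.factorial_succ]
    rw [h3, hd] at h1
    cases m with
    | zero =>
      refine mul_left_cancel₀ hd0 ?_
      push_cast at h1 ⊢
      linear_combination h1
    | succ m =>
      have h2 := ih m (d + 1)
      rw [show n + m + (d + 1) = n + 1 + (m + 1) + d - 1 by omega, hd,
        show n + (d + 1) = n + 1 + d by ring, show m + (d + 1) = m + 1 + d by ring] at h2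
      rw [Nat.add_sub_cancel]
      refine mul_left_cancel₀ hd0 ?_
      push_cast at h1 h2 ⊢
      linear_combination h1 - (m + 1) * h2

open Nat in
theorem saalschutzSum_sub_of_fixed (b n m L : ℕ) (hL : n + 1 ≤ L) :
    (b + (n + 1)) * saalschutzSum b (n + 1) m (L + 1) -
      (n + 1) * (b + L + 1) * saalschutzSum b n m L =
      b * (L - n) * vandermondeSum (n + 1) m L := by
  unfold saalschutzSum vandermondeSum
  have hext : ∑ t ∈ Finset.range (n + 1), (-1 : ℚ) ^ t * pochRatio b t * (L - t)! *
      n.choose t * (m.choose t * t !) = ∑ t ∈ Finset.range (n + 1 + 1), (-1 : ℚ) ^ t *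
      pochRatio b t * (L - t)! * n.choose t * (m.choose t * t !) := by
    rw [Finset.sum_range_succ _ (n + 1)]
    simp
  rw [hext, Finset.mul_sum, Finset.mul_sum, Finset.mul_sum, ← Finset.sum_sub_distrib]
  refine Finset.sum_congr rfl fun t ht => ?_
  have ht' : t ≤ n + 1 := by simpa [Nat.lt_succ_iff] using ht
  have h1 : (L + 1 - t)! = (L + 1 - t : ℚ) * (L - t)! := by
    rw [show L + 1 - t = L - t + 1 by omega, Nat.factorial_succ]
    push_cast [Nat.cast_sub (ht'.trans hL)]
    ring
  have h2 : (n + 1 : ℚ) * n.choose t = (n + 1 - t) * (n + 1).choose t := by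
    have h := Nat.add_one_mul_choose_eq n t
    have h' := Nat.choose_succ_right_eq (n + 1) t
    rw [← h] at h'
    have h'' := congrArg (Nat.cast : ℕ → ℚ) h'
    push_cast [Nat.cast_sub ht'] at h''
    linear_combination h''
  have h3 := pochRatio_mul b t
  rw [h1]
  linear_combination (-(-1 : ℚ) ^ t * pochRatio b t * (L - t)! * (m.choose t * t !) *
    (b + L + 1)) * h2 + ((-1 : ℚ) ^ t * (L - t)! * (n + 1).choose t * (m.choose t * t !) *
    (L - n)) * h3

open Nat in
theorem saalschutzSum_sub_of_shift (b n m L : ℕ) (hL : n ≤ L) :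
    saalschutzSum b n m (L + 1) - n * m * (b + L + 1) / (b + 1) *
      saalschutzSum (b + 1) (n - 1) (m - 1) (L - 1) = (L + 1) * vandermondeSum n m L := by
  have hshift : n * m / (b + 1) * saalschutzSum (b + 1) (n - 1) (m - 1) (L - 1) =
      - ∑ t ∈ Finset.range (n + 1), (-1 : ℚ) ^ t * (t / (b + t)) * (L - t)! *
        n.choose t * (m.choose t * t !) := by
    rw [Finset.sum_range_succ']
    cases n with
    | zero => simp
    | succ n =>
      rw [Nat.add_sub_cancel, saalschutzSum, Finset.mul_sum]
      simp only [Nat.cast_zero, zero_div, mul_zero, zero_mul, add_zero,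
        ← Finset.sum_neg_distrib]
      refine Finset.sum_congr rfl fun t _ => ?_
      have h := choose_succ_mul_factorial m t
      have h2 := Nat.add_one_mul_choose_eq n t
      have h2' := congrArg (Nat.cast : ℕ → ℚ) h2
      have h3 := pochRatio_mul (b + 1) t
      have h4 : pochRatio (b + 1) t / (b + 1) = 1 / (b + (t + 1 : ℕ)) := by
        have : (b + 1 : ℚ) ≠ 0 := by positivity
        have : (b + (t + 1 : ℕ) : ℚ) ≠ 0 := by positivity
        field_simp
        push_cast at h3 ⊢
        linear_combination h3
      push_cast at h h2'
      rw [h, show L - 1 - t = L - (t + 1) by omega]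
      have h5 : ((t + 1 : ℕ) : ℚ) / (b + (t + 1 : ℕ)) =
          (t + 1) * (pochRatio (b + 1) t / (b + 1)) := by
        rw [h4]; push_cast; ring
      rw [h5]
      push_cast
      linear_combination (m * (-1 : ℚ) ^ t * (pochRatio (b + 1) t / (b + 1)) *
        (L - (t + 1))! * ((m - 1).choose t * t !)) * h2'
  have hrw : n * m * (b + L + 1) / (b + 1) * saalschutzSum (b + 1) (n - 1) (m - 1) (L - 1) =
      (b + L + 1) * (n * m / (b + 1) * saalschutzSum (b + 1) (n - 1) (m - 1) (L - 1)) := by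
    ring
  rw [hrw, hshift, mul_neg, sub_neg_eq_add, saalschutzSum, vandermondeSum, Finset.mul_sum,
    Finset.mul_sum, ← Finset.sum_add_distrib]
  refine Finset.sum_congr rfl fun t ht => ?_
  have ht' : t ≤ n := by simpa [Nat.lt_succ_iff] using ht
  have h1 : (L + 1 - t)! = (L + 1 - t : ℚ) * (L - t)! := by
    rw [show L + 1 - t = L - t + 1 by omega, Nat.factorial_succ]
    push_cast [Nat.cast_sub (ht'.trans hL)]
    ring
  have h2 : pochRatio b t * (L + 1 - t) + (b + L + 1) * (t / (b + t)) = L + 1 := by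
    unfold pochRatio
    split_ifs with h
    · simp [h]
    · have : (b + t : ℚ) ≠ 0 := by positivity
      field_simp
      ring
  rw [h1]
  linear_combination ((-1 : ℚ) ^ t * (L - t)! * n.choose t * (m.choose t * t !)) * h2

theorem rF_succ (x : ℚ) (n : ℕ) : rF x (n + 1) = x * rF (x + 1) n := by
  rw [rF, Finset.prod_range_succ', mul_comm]
  simp [rF, add_assoc, add_comm (1 : ℚ)]

open Nat in
theorem rF_natCast_add_one (x n : ℕ) : rF ((x : ℚ) + 1) n * x ! = (x + n)! := by
  induction n generalizing x with
  | zero => simp [rF]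
  | succ n ih =>
    have h := ih (x + 1)
    rw [rF_succ, show x + (n + 1) = x + 1 + n by ring, ← h, Nat.factorial_succ]
    push_cast
    ring

open Nat in
/-- The solution of the Toeplitz system of binomial coefficients with right-hand side
`(b + m).choose (b + s)`, in row `r` out of `n + r + 1`. -/
def solCoeff (b κ m n r : ℕ) : ℚ :=
  (-1) ^ r * (r + κ)! / (r ! * κ !) * ((b + m)! * (b + n)!) /
    ((b + (n + r + m + κ) + 1)! * b ! * n ! * m !) * saalschutzSum b n m (n + r + m + κ + 1)

open Nat in
theorem solCoeff_zero (b κ m r : ℕ) : solCoeff b κ m 0 r =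
    (b + m)! * (r + κ)! / ((b + (r + m + κ) + 1)! * m ! * κ !) *
      ((-1) ^ r * rF b 0 * (m + κ + 1 + r)! / (0 ! * r !)) := by
  have h : saalschutzSum b 0 m (0 + r + m + κ + 1) = (m + κ + 1 + r)! := by
    rw [show 0 + r + m + κ + 1 = m + κ + 1 + r by ring]
    simp [saalschutzSum, pochRatio]
  have hb := Nat.factorial_ne_zero b
  rw [solCoeff, h, zero_add, add_zero]
  simp only [rF, Finset.range_zero, Finset.prod_empty, Nat.factorial_zero]
  field_simp

open Nat in
theorem solCoeff_succ (b κ m n r : ℕ) : solCoeff b κ m (n + 1) r = solCoeff b κ m n r +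
    (b + m)! * (n + 1 + r + κ)! / ((b + (n + 1 + r + m + κ) + 1)! * m ! * κ !) *
      ((-1) ^ r * rF b (n + 1) * (m + κ + 1 + r)! / ((n + 1)! * r !)) := by
  have hS := saalschutzSum_sub_of_fixed b n m (n + 1 + r + m + κ) (by omega)
  have hV := vandermondeSum_eq (n + 1) m (r + κ)
  rw [show n + 1 + m + (r + κ) = n + 1 + r + m + κ by ring] at hV
  have hrF : rF b (n + 1) * b ! = b * (b + n)! := by
    rw [rF_succ, mul_assoc, rF_natCast_add_one]
  have e1 : (b + (n + 1))! = (b + n + 1) * (b + n)! := Nat.factorial_succ _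
  have e2 : (b + (n + 1 + r + m + κ) + 1)! =
      (b + (n + 1 + r + m + κ) + 1) * (b + (n + r + m + κ) + 1)! := by
    rw [Nat.factorial_succ]
    congr 2
    ring
  have e3 : (m + κ + 1 + r)! = (m + κ + 1 + r) * (m + (r + κ))! := by
    rw [show m + κ + 1 + r = m + (r + κ) + 1 by ring, Nat.factorial_succ]
  have e4 : (n + 1)! = (n + 1) * n ! := Nat.factorial_succ _
  have hb : ((b ! : ℕ) : ℚ) ≠ 0 := mod_cast Nat.factorial_ne_zero b
  have hk : (((r + κ)! : ℕ) : ℚ) ≠ 0 := mod_cast Nat.factorial_ne_zero _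
  have hbn : (((b + n)! : ℕ) : ℚ) ≠ 0 := mod_cast Nat.factorial_ne_zero _
  have hA : (((b + (n + r + m + κ) + 1)! : ℕ) : ℚ) ≠ 0 := mod_cast Nat.factorial_ne_zero _
  have hA1 : (b + (n + 1 + r + m + κ) + 1 : ℚ) ≠ 0 := by positivity
  have hn1 : (n + 1 : ℚ) ≠ 0 := by positivity
  rw [← eq_div_iff hb] at hrF
  rw [← eq_div_iff hk] at hV
  rw [hV] at hS
  rw [hrF, ← sub_eq_iff_eq_add', solCoeff, solCoeff, e1, e2, e3, e4,
    show n + 1 + r + κ = n + 1 + (r + κ) by ring, show n + r + m + κ + 1 = n + 1 + r + m + κ by ring]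
  rw [← sub_eq_zero] at hS ⊢
  have key : ∀ S₁ S₀ : ℚ, (-1) ^ r * (r + κ)! / (r ! * κ !) * ((b + m)! * ((b + n + 1) * (b + n)! : ℕ)) /
      (((b + (n + 1 + r + m + κ) + 1) * (b + (n + r + m + κ) + 1)! : ℕ) * b ! *
        ((n + 1) * n ! : ℕ) * m !) * S₁ - (-1) ^ r * (r + κ)! / (r ! * κ !) *
      ((b + m)! * (b + n)!) / ((b + (n + r + m + κ) + 1)! * b ! * n ! * m !) * S₀ =
      ((-1) ^ r * (r + κ)! / (r ! * κ !) * ((b + m)! * (b + n)!) /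
      (((b + (n + 1 + r + m + κ) + 1) * (b + (n + r + m + κ) + 1)!) * b ! *
        ((n + 1) * n !) * m !)) * ((b + (n + 1)) * S₁ -
        (n + 1) * (b + (n + 1 + r + m + κ) + 1) * S₀) := by
    intro S₁ S₀
    push_cast
    field_simp
    ring
  rw [key]
  push_cast at hS ⊢
  rw [sub_eq_zero] at hS
  rw [hS]
  field_simp
  ring

open Nat in
theorem solCoeff_shift (b κ m n r : ℕ) : solCoeff b κ m n r =
    (if n = 0 ∨ m = 0 then 0 else solCoeff (b + 1) κ (m - 1) (n - 1) r) +
    (b + m)! * (n + r + m + κ + 1) * (n + r + κ)! /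
        ((b + (n + r + m + κ) + 1)! * b ! * m ! * κ !) *
      ((-1) ^ r * (b + n)! * (m + κ + r)! / (n ! * r !)) := by
  have hS := saalschutzSum_sub_of_shift b n m (n + r + m + κ) (by omega)
  have hV := vandermondeSum_eq n m (r + κ)
  rw [show n + m + (r + κ) = n + r + m + κ by ring] at hV
  have hk : (((r + κ)! : ℕ) : ℚ) ≠ 0 := mod_cast Nat.factorial_ne_zero _
  have hA : (((b + (n + r + m + κ) + 1)! : ℕ) : ℚ) ≠ 0 := mod_cast Nat.factorial_ne_zero _
  rw [← eq_div_iff hk] at hV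
  rw [hV] at hS
  have hprev : (if n = 0 ∨ m = 0 then 0 else solCoeff (b + 1) κ (m - 1) (n - 1) r) =
      (-1) ^ r * (r + κ)! / (r ! * κ !) * ((b + m)! * (b + n)!) /
      ((b + (n + r + m + κ) + 1)! * b ! * n ! * m !) *
      (n * m * (b + (n + r + m + κ : ℕ) + 1) / (b + 1) *
        saalschutzSum (b + 1) (n - 1) (m - 1) (n + r + m + κ - 1)) := by
    split_ifs with h
    · rcases h with rfl | rfl <;> simp
    · push Not at h
      obtain ⟨n, rfl⟩ := Nat.exists_eq_succ_of_ne_zero h.1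
      obtain ⟨m, rfl⟩ := Nat.exists_eq_succ_of_ne_zero h.2
      simp only [Nat.succ_eq_add_one, Nat.add_sub_cancel]
      rw [solCoeff, show n + 1 + r + (m + 1) + κ - 1 = n + r + m + κ + 1 by omega,
        show b + 1 + (n + r + m + κ) + 1 = b + (n + r + m + κ) + 2 by ring,
        show b + (n + 1 + r + (m + 1) + κ) + 1 = b + (n + r + m + κ) + 2 + 1 by ring,
        Nat.factorial_succ (b + (n + r + m + κ) + 2), Nat.factorial_succ b, Nat.factorial_succ n,
        Nat.factorial_succ m, show b + 1 + m = b + (m + 1) by ring,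
        show b + 1 + n = b + (n + 1) by ring]
      have h1 : (((b + (n + r + m + κ) + 2)! : ℕ) : ℚ) ≠ 0 := mod_cast Nat.factorial_ne_zero _
      have h2 : (b + (n + r + m + κ) + 2 + 1 : ℚ) ≠ 0 := by positivity
      push_cast
      field_simp
      ring
  have hsplit := sub_eq_iff_eq_add'.1 hS
  rw [hprev, solCoeff, hsplit, mul_add, add_right_inj,
    show n + r + κ = n + (r + κ) by ring, show m + κ + r = m + (r + κ) by ring]
  push_cast
  field_simp

open Nat in
theorem sum_kernel_first (b c N s : ℕ) (hs : s ≤ N) : ∑ r ∈ Finset.range (N + 2),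
    (-1 : ℚ) ^ r * rF b (N + 1 - r) * (c + r)! / ((N + 1 - r)! * r !) *
      pathCount (b + c : ℕ) (b + s - r) = 0 := by
  cases b with
  | zero =>
    refine Finset.sum_eq_zero fun r hr => ?_
    rcases Nat.eq_or_lt_of_le (Nat.lt_succ_iff.1 (Finset.mem_range.1 hr)) with rfl | hr
    · rw [pathCount_of_neg (by push_cast; omega)]
      simp
    · obtain ⟨d, hd⟩ : ∃ d, N + 1 - r = d + 1 := ⟨N - r, by omega⟩
      rw [hd, rF_succ]
      simp
  | succ β =>
    have h := sum_choose_mul_descFactorial_eq_zero (N := N + 1) (U := β + 1 + N) (p := N - s)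
      (q := s) c (by omega) (by omega)
    rw [← mul_right_inj' (show (((β + 1 + c)! : ℕ) / (β ! * (N + 1)!) : ℚ) ≠ 0 by positivity),
      mul_zero, Finset.mul_sum] at h
    rw [← h]
    refine Finset.sum_congr rfl fun r hr => ?_
    have hr : r ≤ N + 1 := Nat.lt_succ_iff.1 (Finset.mem_range.1 hr)
    have h1 := factorial_mul_pathCount (u := β + 1 + N - r) (v := c + r) (p := N - s) (q := s)
      (h := β + 1 + c) (z := (β + 1 : ℕ) + s - r) (by omega) (by omega)
    have h2 := rF_natCast_add_one β (N + 1 - r)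
    rw [show β + (N + 1 - r) = β + 1 + N - r by omega] at h2
    have h3 := congrArg (Nat.cast : ℕ → ℚ) (Nat.choose_mul_factorial_mul_factorial hr)
    have h1' := congrArg (Int.cast : ℤ → ℚ) h1
    have hb : ((β ! : ℕ) : ℚ) ≠ 0 := mod_cast Nat.factorial_ne_zero _
    push_cast at h1' h3 ⊢
    rw [← eq_div_iff hb] at h2
    rw [h2, ← h3]
    have hc : (((N + 1).choose r : ℕ) : ℚ) ≠ 0 := mod_cast (Nat.choose_pos hr).ne'
    field_simp
    linear_combination h1'

open Nat in
theorem sum_kernel_last (b c N s : ℕ) (hs : s ≤ N) : ∑ r ∈ Finset.range (N + 2),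
    (-1 : ℚ) ^ r * (b + (N + 1 - r))! * (c + r)! / ((N + 1 - r)! * r !) *
      pathCount (b + c + 1 : ℕ) (b + (s + 1) - r) = 0 := by
  have h := sum_choose_mul_descFactorial_eq_zero (N := N + 1) (U := b + (N + 1)) (p := N - s)
    (q := s) c (by omega) (by omega)
  rw [← mul_right_inj' (show (((b + c + 1)! : ℕ) / ((N + 1)!) : ℚ) ≠ 0 by positivity),
    mul_zero, Finset.mul_sum] at h
  rw [← h]
  refine Finset.sum_congr rfl fun r hr => ?_
  have hr : r ≤ N + 1 := Nat.lt_succ_iff.1 (Finset.mem_range.1 hr)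
  have h1 := factorial_mul_pathCount (u := b + (N + 1) - r) (v := c + r) (p := N - s) (q := s)
    (h := b + c + 1) (z := b + (s + 1) - r) (by omega) (by omega)
  have h3 := congrArg (Nat.cast : ℕ → ℚ) (Nat.choose_mul_factorial_mul_factorial hr)
  have h1' := congrArg (Int.cast : ℤ → ℚ) h1
  rw [show b + (N + 1 - r) = b + (N + 1) - r by omega]
  push_cast at h1' h3 ⊢
  rw [← h3]
  have hc : (((N + 1).choose r : ℕ) : ℚ) ≠ 0 := mod_cast (Nat.choose_pos hr).ne'
  field_simp
  linear_combination h1'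

open Nat in
theorem sum_solCoeff_mul_pathCount (κ N : ℕ) : ∀ b m s : ℕ, s ≤ N →
    ∑ r ∈ Finset.range (N + 1), solCoeff b κ m (N - r) r *
      pathCount (b + (m + κ + 1) : ℕ) (b + s - r) = pathCount (b + m : ℕ) (b + s) := by
  induction N with
  | zero =>
    intro b m s hs
    obtain rfl : s = 0 := by omega
    rw [zero_add, Finset.sum_range_one, Nat.sub_zero, solCoeff_zero]
    have h1 := Nat.choose_mul_factorial_mul_factorial (show b ≤ b + (m + κ + 1) by omega)
    have h2 := Nat.choose_mul_factorial_mul_factorial (show b ≤ b + m by omega)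
    rw [Nat.add_sub_cancel_left] at h1 h2
    simp only [Nat.cast_zero, sub_zero, add_zero, pathCount_natCast]
    rw [show b + (0 + m + κ) + 1 = b + (m + κ + 1) by ring, ← h1, ← h2]
    have hc : (((b + (m + κ + 1)).choose b : ℕ) : ℚ) ≠ 0 :=
      mod_cast (Nat.choose_pos (by omega)).ne'
    simp [rF]
    field_simp
  | succ N ih =>
    intro b m s hs
    by_cases hsN : s ≤ N
    · have hker := sum_kernel_first b (m + κ + 1) N s hsN
      have hterm : ∀ r ∈ Finset.range (N + 2), solCoeff b κ m (N + 1 - r) r *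
          pathCount (b + (m + κ + 1) : ℕ) (b + s - r) =
          (if r = N + 1 then 0 else solCoeff b κ m (N - r) r *
            pathCount (b + (m + κ + 1) : ℕ) (b + s - r)) +
          (b + m)! * (N + 1 + κ)! / ((b + (N + 1 + m + κ) + 1)! * m ! * κ !) *
          ((-1 : ℚ) ^ r * rF b (N + 1 - r) * (m + κ + 1 + r)! / ((N + 1 - r)! * r !) *
            pathCount (b + (m + κ + 1) : ℕ) (b + s - r)) := by
        intro r hr
        have hr : r ≤ N + 1 := Nat.lt_succ_iff.1 (Finset.mem_range.1 hr)
        split_ifs with h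
        · subst h
          rw [Nat.sub_self, solCoeff_zero]
          ring
        · obtain ⟨d, rfl⟩ : ∃ d, N = d + r := ⟨N - r, by omega⟩
          rw [show d + r + 1 - r = d + 1 by omega, Nat.add_sub_cancel, solCoeff_succ,
            show d + 1 + r = d + r + 1 by ring]
          ring
      rw [Finset.sum_congr rfl hterm, Finset.sum_add_distrib, ← Finset.mul_sum, hker, mul_zero,
        add_zero, Finset.sum_range_succ, if_pos rfl, add_zero, ← ih b m s hsN]
      refine Finset.sum_congr rfl fun r hr => if_neg ?_
      have := Finset.mem_range.1 hr
      omega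
    · obtain ⟨s, rfl⟩ : ∃ s', s = s' + 1 := ⟨s - 1, by omega⟩
      have hker := sum_kernel_last b (m + κ) N s (by omega)
      have hterm : ∀ r ∈ Finset.range (N + 2), solCoeff b κ m (N + 1 - r) r *
          pathCount (b + (m + κ + 1) : ℕ) (b + (s + 1 : ℕ) - r) =
          (if r = N + 1 ∨ m = 0 then 0 else solCoeff (b + 1) κ (m - 1) (N - r) r *
            pathCount (b + (m + κ + 1) : ℕ) (b + (s + 1 : ℕ) - r)) +
          (b + m)! * (N + 1 + m + κ + 1) * (N + 1 + κ)! /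
            ((b + (N + 1 + m + κ) + 1)! * b ! * m ! * κ !) *
          ((-1 : ℚ) ^ r * (b + (N + 1 - r))! * (m + κ + r)! / ((N + 1 - r)! * r !) *
            pathCount (b + (m + κ) + 1 : ℕ) (b + (s + 1) - r)) := by
        intro r hr
        have hr : r ≤ N + 1 := Nat.lt_succ_iff.1 (Finset.mem_range.1 hr)
        rw [solCoeff_shift, show N + 1 - r + r = N + 1 by omega, Nat.cast_sub hr,
          show N + 1 - r - 1 = N - r by omega]
        have h0 : N + 1 - r = 0 ↔ r = N + 1 := by omega
        simp only [h0]
        rw [add_mul, ite_mul, zero_mul]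
        push_cast
        ring_nf
      rw [Finset.sum_congr rfl hterm, Finset.sum_add_distrib, ← Finset.mul_sum, hker, mul_zero,
        add_zero]
      cases m with
      | zero =>
        rw [pathCount_of_lt (by positivity) (by push_cast; omega)]
        simp
      | succ m =>
        have h := ih (b + 1) m s (by omega)
        rw [Finset.sum_range_succ, if_pos (Or.inl rfl), add_zero,
          show b + (m + 1) = b + 1 + m by ring,
          show (b : ℤ) + (s + 1 : ℕ) = (b + 1 : ℕ) + s by push_cast; ring, ← h]
        refine Finset.sum_congr rfl fun r hr => ?_
        have := Finset.mem_range.1 hr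
        rw [if_neg (by omega), Nat.add_sub_cancel,
          show b + (m + 1 + κ + 1) = b + 1 + (m + κ + 1) by ring]

/-- The `N × N` Toeplitz matrix of binomial coefficients `(b + c).choose (b + s - r)`. -/
def binomToeplitz (b c N : ℕ) : Matrix (Fin N) (Fin N) ℚ :=
  Matrix.of fun r s => (pathCount (b + c : ℕ) ((b : ℤ) + (s : ℕ) - (r : ℕ)) : ℚ)

theorem det_binomToeplitz_updateRow (b κ m n r : ℕ) :
    ((binomToeplitz b (m + κ + 1) (n + r + 1)).updateRow ⟨r, by omega⟩
      fun s => (pathCount (b + m : ℕ) ((b : ℤ) + (s : ℕ)) : ℚ)).det =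
      solCoeff b κ m n r * (binomToeplitz b (m + κ + 1) (n + r + 1)).det := by
  have h := Matrix.det_updateRow_sum (binomToeplitz b (m + κ + 1) (n + r + 1)) ⟨r, by omega⟩
    fun i : Fin (n + r + 1) => solCoeff b κ m (n + r - i) i
  rw [smul_eq_mul, show n + r - (⟨r, by omega⟩ : Fin (n + r + 1)).val = n by simp] at h
  rw [← h]
  congr 2
  funext s
  rw [← sum_solCoeff_mul_pathCount κ (n + r) b m s (by omega), Finset.sum_range, Finset.sum_apply]
  exact Finset.sum_congr rfl fun i _ => rfl

open Nat in
theorem det_binomToeplitz (b κ N : ℕ) : (binomToeplitz b (κ + 1) N).det =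
    ∏ i ∈ Finset.range N, ((b + κ + 1 + i)! * i ! : ℚ) / ((b + i)! * (κ + 1 + i)!) := by
  induction N with
  | zero => simp
  | succ N ih =>
    have h := det_binomToeplitz_updateRow b κ 0 N 0
    rw [Matrix.det_succ_row_zero] at h
    rw [Finset.sum_eq_single 0] at h
    · have hsub : ((binomToeplitz b (0 + κ + 1) (N + 0 + 1)).updateRow ⟨0, by omega⟩
          fun s => (pathCount (b + 0 : ℕ) ((b : ℤ) + (s : ℕ)) : ℚ)).submatrix Fin.succ
            (Fin.succAbove 0) = binomToeplitz b (κ + 1) N := by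
        ext i j
        rw [Matrix.submatrix_apply, Matrix.updateRow_ne (by simp [Fin.ext_iff])]
        simp [binomToeplitz]
        congr 1
        ring
      rw [hsub, ih] at h
      have hS : saalschutzSum b N 0 (N + 0 + 0 + κ + 1) = (κ + 1 + N)! := by
        rw [saalschutzSum, Finset.sum_range_succ', Finset.sum_eq_zero]
        · simp [pochRatio, show N + κ + 1 = κ + 1 + N by ring]
        · simp
      rw [solCoeff, hS] at h
      simp [pathCount, Matrix.updateRow_apply, -Finset.prod_div_distrib] at h
      rw [Finset.prod_range_succ, h]
      generalize (binomToeplitz b (κ + 1) (N + 1)).det = D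
      have e1 : b + (N + κ) + 1 = b + κ + 1 + N := by ring
      rw [e1]
      have h1 : (((b + κ + 1 + N)! : ℕ) : ℚ) ≠ 0 := mod_cast Nat.factorial_ne_zero _
      have h2 : (((b + N)! : ℕ) : ℚ) ≠ 0 := mod_cast Nat.factorial_ne_zero _
      have h3 : (((κ + 1 + N)! : ℕ) : ℚ) ≠ 0 := mod_cast Nat.factorial_ne_zero _
      have h4 : ((N ! : ℕ) : ℚ) ≠ 0 := mod_cast Nat.factorial_ne_zero _
      have h5 : ((b ! : ℕ) : ℚ) ≠ 0 := mod_cast Nat.factorial_ne_zero _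
      have h6 : ((κ ! : ℕ) : ℚ) ≠ 0 := mod_cast Nat.factorial_ne_zero _
      field_simp
    · intro j _ hj
      have hj0 : 0 < (j : ℕ) := Nat.pos_of_ne_zero (Fin.val_ne_of_ne hj)
      have : pathCount b ((b : ℤ) + (j : ℕ)) = 0 := pathCount_of_lt (by omega) (by omega)
      simp [Matrix.updateRow_apply, this]
    · simp

theorem det_cons_succAbove {R : Type*} [CommRing R] {n : ℕ} (A : Matrix (Fin (n + 1)) (Fin (n + 1)) R)
    (r : Fin (n + 1)) (w : Fin (n + 1) → R) :
    (Matrix.of (Fin.cons w fun i => A (r.succAbove i))).det =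
      (-1) ^ (r : ℕ) * (A.updateRow r w).det := by
  rw [Matrix.det_succ_row_zero, Matrix.det_succ_row (A.updateRow r w) r, Finset.mul_sum]
  refine Finset.sum_congr rfl fun s _ => ?_
  have h1 : (Matrix.of (Fin.cons w fun i => A (r.succAbove i))).submatrix Fin.succ s.succAbove =
      A.submatrix r.succAbove s.succAbove := by
    ext i j
    simp
  have h2 : ((-1 : R) ^ (r : ℕ)) * (-1) ^ (r : ℕ) = 1 := by
    rw [← mul_pow]
    simp
  rw [h1, Matrix.submatrix_updateRow_succAbove, Matrix.updateRow_self, pow_add]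
  simp only [Matrix.of_apply, Fin.cons_zero]
  linear_combination (-(-1) ^ (s : ℕ) * w s * (A.submatrix r.succAbove s.succAbove).det) * h2

/-- The starting positions of the paths in the hexagon with two dents on adjacent sides. -/
def dentStart (n b k : ℕ) (r : Fin (n + 1)) : Fin (n + 1) → ℤ × ℤ :=
  Fin.cons ((n : ℤ) + b, (k : ℤ)) fun i : Fin n => ((n : ℤ) + b - (r.succAbove i : ℕ), 0)

theorem reachable_dentStart {n b c k : ℕ} (r : Fin (n + 1)) (hk1 : 1 ≤ k) (hk2 : k ≤ c) :
    Reachable n b c 0 (dentStart n b k r) := by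
  have hs : ∀ i : Fin n, ((r.succAbove i : ℕ) : ℤ) ≤ n := fun i => by
    have := (r.succAbove i).isLt
    omega
  refine ⟨?_, ?_, ?_, ?_, ?_, ?_, ?_, ?_⟩
  iterate 7
    intro i
    cases i using Fin.cases with
    | zero => simp [dentStart] <;> omega
    | succ i =>
      have := hs i
      simp [dentStart] <;> omega
  intro i j hij
  cases j using Fin.cases with
  | zero => exact absurd hij (by simp)
  | succ j =>
    cases i using Fin.cases with
    | zero =>
      simp only [dentStart, Fin.cons_zero, Fin.cons_succ, true_and]
      omega
    | succ i =>
      have : r.succAbove i < r.succAbove j :=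
        Fin.strictMono_succAbove r (by simpa using hij)
      simp only [dentStart, Fin.cons_succ]
      omega

theorem pathRegion_dentStart {n b c k : ℕ} (r : Fin (n + 1)) (hk1 : 1 ≤ k) :
    pathRegion (n + 1) b c 0 (dentStart n b k r) =
      Hex (n + 1) b c \ {((n : ℤ) + b - (r : ℕ), 0, true), ((n : ℤ) + b, (k : ℤ) - 1, false)} := by
  ext ⟨x, y, ε⟩
  cases ε
  · have h : (∀ i, dentStart n b k r i ≠ (x, y + 1)) ↔
        ¬ (x = n + b ∧ y = k - 1) ∧ (y = -1 → ∀ i : Fin n, x ≠ n + b - (r.succAbove i : ℕ)) := by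
      rw [Fin.forall_fin_succ]
      simp [dentStart, Prod.ext_iff]
      grind
    simp only [pathRegion, Set.mem_sdiff, Set.mem_ofPred_eq, Set.mem_insert_iff,
      Set.mem_singleton_iff, Prod.mk.injEq, Bool.false_eq_true, false_imp_iff,
      true_and, and_true, and_false, false_or, true_imp_iff, h, mem_hex_down]
    constructor
    · rintro ⟨h1, h2, h3, -⟩
      exact ⟨h1, h3⟩
    · rintro ⟨h1, h3⟩
      exact ⟨h1, h1.2.2.1, h3, fun hy => by omega⟩
  · have h : (∃ i, dentStart n b k r i = (x, 0)) ↔ ∃ i : Fin n, n + b - ((r.succAbove i : ℕ) : ℤ) = x := by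
      rw [Fin.exists_fin_succ]
      simp [dentStart, Prod.ext_iff]
      omega
    simp only [pathRegion, Set.mem_sdiff, Set.mem_ofPred_eq, Set.mem_insert_iff,
      Set.mem_singleton_iff, Prod.mk.injEq, Bool.true_eq_false, false_imp_iff, true_imp_iff,
      and_true, and_false, or_false, h, mem_hex_up]
    constructor
    · rintro ⟨h1, h2, h3⟩
      refine ⟨h1, ?_⟩
      rintro ⟨rfl, rfl⟩
      obtain ⟨i, hi⟩ := h3 rfl
      exact r.succAbove_ne i (Fin.ext (by omega))
    · rintro ⟨h1, h3⟩
      refine ⟨h1, h1.2.2.1, ?_⟩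
      rintro rfl
      have hx : (n + b - x).toNat < n + 1 := by omega
      obtain ⟨i, hi⟩ := Fin.exists_succAbove_eq (x := ⟨(n + b - x).toNat, hx⟩) (y := r) (by
        intro hr
        have hr' := congrArg Fin.val hr
        simp only at hr'
        exact h3 ⟨by omega, rfl⟩)
      exact ⟨i, by rw [hi, Int.toNat_of_nonneg (by omega)]; ring⟩

open Nat in
theorem M_adjacent_dents_eq (b κ m n r : ℕ) :
    (M (Hex (n + r + 1) b (m + κ + 1) \
      {((n : ℤ) + b, 0, true), ((n : ℤ) + r + b, (κ : ℤ), false)}) : ℚ) =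
      (-1) ^ r * (solCoeff b κ m n r * ∏ i ∈ Finset.range (n + r + 1),
        ((b + (m + κ) + 1 + i)! * i ! : ℚ) / ((b + i)! * (m + κ + 1 + i)!)) := by
  let R : Fin (n + r + 1) := ⟨r, by omega⟩
  have hR := reachable_dentStart (b := b) (c := m + κ + 1) (k := κ + 1) R (by omega) (by omega)
  have hM := hR.M_eq_det le_rfl (by positivity)
  rw [pathRegion_dentStart R (by omega)] at hM
  have e : Hex (n + r + 1) b (m + κ + 1) \
      {((n : ℤ) + b, 0, true), ((n : ℤ) + r + b, (κ : ℤ), false)} = Hex (n + r + 1) b (m + κ + 1) \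
      {(((n + r : ℕ) : ℤ) + b - (R : ℕ), 0, true),
        (((n + r : ℕ) : ℤ) + b, ((κ + 1 : ℕ) : ℤ) - 1, false)} := by
    have h1 : ((n + r : ℕ) : ℤ) + b - (R : ℕ) = n + b := by simp [R]; ring
    have h2 : ((κ + 1 : ℕ) : ℤ) - 1 = κ := by simp
    rw [h1, h2, Nat.cast_add]
  rw [e, ← Int.cast_natCast, hM, Int.cast_det, ← det_binomToeplitz, ← det_binomToeplitz_updateRow]
  refine Eq.trans ?_ (det_cons_succAbove (binomToeplitz b (m + κ + 1) (n + r + 1)) R _)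
  congr 1
  ext i s
  cases i using Fin.cases with
  | zero =>
    simp [pathMatrix, dentStart]
    congr 2
    ring
  | succ i =>
    simp [pathMatrix, dentStart, binomToeplitz]
    congr 1
    ring

open Nat in
theorem rF_neg_natCast (n t : ℕ) : rF (-(n : ℚ)) t = (-1) ^ t * (n.choose t * t !) := by
  induction t with
  | zero => simp [rF]
  | succ t ih =>
    rw [rF, Finset.prod_range_succ, ← rF, ih]
    have h : ((n.choose (t + 1) : ℕ) : ℚ) * (t + 1) = n.choose t * (n - t) := by
      rcases le_or_gt t n with htn | htn
      · rw [← Nat.cast_sub htn]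
        exact_mod_cast Nat.choose_succ_right_eq n t
      · simp [Nat.choose_eq_zero_of_lt htn, Nat.choose_eq_zero_of_lt (htn.trans (Nat.lt_succ_self t))]
    rw [Nat.factorial_succ, pow_succ]
    push_cast
    linear_combination (-1) ^ t * t ! * h

open Nat in
/-- The hypergeometric series of two dents on adjacent sides, as a Saalschütz type sum. -/
theorem hyp_eq_saalschutzSum (b n m L : ℕ) (hn : n ≤ L) :
    hyp [-(n : ℚ), b, -(m : ℚ)] [-(L : ℚ), 1 + b] = saalschutzSum b n m L / L ! := by
  rw [hyp, tsum_eq_sum (s := Finset.range (n + 1)), saalschutzSum, Finset.sum_div]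
  · refine Finset.sum_congr rfl fun t ht => ?_
    have htn : t ≤ n := Nat.lt_succ_iff.1 (Finset.mem_range.1 ht)
    have hL : ((L.choose t * t ! : ℕ) : ℚ) * (L - t)! = L ! := by
      rw [← Nat.choose_mul_factorial_mul_factorial (htn.trans hn)]
      push_cast
      ring
    have hb : rF b t = pochRatio b t * rF (1 + b) t := by
      rcases t with _ | t
      · simp [pochRatio, rF]
      · have h1 : rF (1 + b) (t + 1) = rF (b + 1) t * (b + (t + 1 : ℕ)) := by
          rw [rF, Finset.prod_range_succ, add_comm (1 : ℚ), ← rF]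
          push_cast
          ring
        rw [h1, mul_comm (rF _ t), ← mul_assoc, pochRatio_mul, rF_succ]
    have h1 : rF (1 + b) t ≠ 0 := by
      rw [rF]
      positivity
    have h2 : ((t ! : ℕ) : ℚ) ≠ 0 := mod_cast Nat.factorial_ne_zero _
    have h3 : ((L - t)! : ℚ) ≠ 0 := mod_cast Nat.factorial_ne_zero _
    have h4 : ((L.choose t : ℕ) : ℚ) ≠ 0 := mod_cast (Nat.choose_pos (htn.trans hn)).ne'
    have h5 : ((-1) ^ t : ℚ) ≠ 0 := by simp
    simp only [List.map_cons, List.map_nil, List.prod_cons, List.prod_nil, mul_one]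
    rw [rF_neg_natCast, rF_neg_natCast, rF_neg_natCast, hb, ← hL]
    push_cast
    field_simp
  · intro t ht
    have htn : n < t := by simpa using ht
    simp [rF_neg_natCast, Nat.choose_eq_zero_of_lt htn]

open Nat in
theorem prod_rF_eq (b c a : ℕ) :
    (∏ i ∈ Finset.range a, rF ((c + 1 : ℕ) + i) b / rF (1 + i) b) *
      ((b + c + a)! * c !) =
    (∏ i ∈ Finset.range a, ((b + c + 1 + i)! * i ! : ℚ) / ((b + i)! * (c + 1 + i)!)) *
      ((b + c)! * (c + a)!) := by
  induction a with
  | zero => simp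
  | succ a ih =>
    have h1 : rF ((c + 1 : ℕ) + a) b * (c + a)! = (b + c + a)! := by
      rw [show (((c + 1 : ℕ) : ℚ) + a) = (c + a : ℕ) + 1 by push_cast; ring, rF_natCast_add_one,
        show c + a + b = b + c + a by ring]
    have h2 : rF (1 + a) b * a ! = (b + a)! := by
      rw [add_comm (1 : ℚ), rF_natCast_add_one, add_comm a]
    have h3 : (((c + a)! : ℕ) : ℚ) ≠ 0 := mod_cast Nat.factorial_ne_zero _
    have h4 : ((a ! : ℕ) : ℚ) ≠ 0 := mod_cast Nat.factorial_ne_zero _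
    have h5 : (((b + a)! : ℕ) : ℚ) ≠ 0 := mod_cast Nat.factorial_ne_zero _
    have h6 : (((c + 1 + a)! : ℕ) : ℚ) ≠ 0 := mod_cast Nat.factorial_ne_zero _
    rw [← eq_div_iff h3] at h1
    rw [← eq_div_iff h4] at h2
    rw [Finset.prod_range_succ, Finset.prod_range_succ, h1, h2,
      show b + c + (a + 1) = b + c + 1 + a by ring, show c + (a + 1) = c + 1 + a by ring]
    have e : ∀ P Q : ℚ, P * ((b + c + a)! * c !) = Q * ((b + c)! * (c + a)!) →
        P * ((b + c + a)! / (c + a)! / ((b + a)! / a !)) * ((b + c + 1 + a)! * c !) =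
        Q * ((b + c + 1 + a)! * a ! / ((b + a)! * (c + 1 + a)!)) * ((b + c)! * (c + 1 + a)!) := by
      intro P Q h
      field_simp
      linear_combination h
    exact e _ _ ih

open Nat in
theorem M_adjacent_dents (b κ m n r : ℕ) :
    (M (Hex (n + r + 1) b (m + κ + 1) \
      {((n : ℤ) + b, 0, true), ((n : ℤ) + r + b, (κ : ℤ), false)}) : ℚ) =
      (∏ i ∈ Finset.range (n + r + 1), rF ((m + κ + 1 : ℕ) + i) b / rF (1 + i) b) *
      hyp [-(n : ℚ), b, -(m : ℚ)] [-((n + r + m + κ + 1 : ℕ) : ℚ), 1 + b] *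
      (rF (1 + b) n * rF (r + 1) κ * rF (m + 1) κ) /
      (rF 1 n * rF 1 κ * rF ((b + m : ℕ) + 1) κ) := by
  have hH := hyp_eq_saalschutzSum b n m (n + r + m + κ + 1) (by omega)
  have hP := prod_rF_eq b (m + κ) (n + r + 1)
  have r1 : rF (1 + b) n * b ! = (b + n)! := by rw [add_comm (1 : ℚ), rF_natCast_add_one]
  have r2 : rF (r + 1) κ * r ! = (r + κ)! := rF_natCast_add_one r κ
  have r3 : rF (m + 1) κ * m ! = (m + κ)! := rF_natCast_add_one m κ
  have r4 : rF 1 n = n ! := by simpa using rF_natCast_add_one 0 n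
  have r5 : rF 1 κ = κ ! := by simpa using rF_natCast_add_one 0 κ
  have r6 : rF ((b + m : ℕ) + 1) κ * (b + m)! = (b + m + κ)! := rF_natCast_add_one (b + m) κ
  have fne : ∀ x : ℕ, ((x ! : ℕ) : ℚ) ≠ 0 := fun x => mod_cast Nat.factorial_ne_zero x
  rw [M_adjacent_dents_eq, hH, eq_div_of_mul_eq (fne b) r1, eq_div_of_mul_eq (fne r) r2,
    eq_div_of_mul_eq (fne m) r3, r4, r5,
    eq_div_of_mul_eq (fne (b + m)) r6, eq_div_of_mul_eq (mul_ne_zero (fne _) (fne _)) hP, solCoeff,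
    show b + (n + r + m + κ) + 1 = b + (m + κ) + (n + r + 1) by ring,
    show m + κ + (n + r + 1) = n + r + m + κ + 1 by ring, add_assoc b m κ]
  have hsign : ((-1 : ℚ) ^ r) * (-1) ^ r = 1 := by
    rw [← mul_pow]
    simp
  have f1 := fne b
  have f2 := fne r
  have f3 := fne m
  have f4 := fne n
  have f5 := fne κ
  have f6 := fne (b + m)
  have f7 := fne (b + (m + κ))
  have f8 := fne (m + κ)
  have f9 := fne (n + r + m + κ + 1)
  have f10 := fne (b + (m + κ) + (n + r + 1))
  generalize (∏ i ∈ Finset.range (n + r + 1),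
    ((b + (m + κ) + 1 + i)! * i ! : ℚ) / ((b + i)! * (m + κ + 1 + i)!)) = D
  generalize saalschutzSum b n m (n + r + m + κ + 1) = S
  generalize (-1 : ℚ) ^ r = ε at hsign ⊢
  field_simp
  linear_combination S * D * hsign

/-- Proposition 3.1: the number of lozenge tilings of the hexagon `H_{a,b,c}` with two dents
of opposite orientations on the adjacent sides of lengths `a` and `c`, in positions `j`
and `k` respectively, counted from the common vertex of the two sides.  In coordinates,
the dents are the up-pointing triangle `(a+b-j, 0)` on the southern side (of length `a`)
and the down-pointing triangle `(a+b-1, k-1)` on the adjacent southeastern side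
(of length `c`). -/
theorem adjacent_dents (a b c j k : ℕ) (hj1 : 1 ≤ j) (hj2 : j ≤ a) (hk1 : 1 ≤ k) (hk2 : k ≤ c) :
    (M (Hex a b c \ {((a : ℤ) + b - j, 0, true), ((a : ℤ) + b - 1, (k : ℤ) - 1, false)}) : ℚ) =
      (∏ i ∈ Finset.range a, rF ((c : ℚ) + i) b / rF (1 + (i : ℚ)) b) *
      hyp [-(a : ℚ) + j, (b : ℚ), -(c : ℚ) + k] [1 - (a : ℚ) - c, 1 + (b : ℚ)] *
      (rF (1 + (b : ℚ)) (a - j) * rF (j : ℚ) (k - 1) * rF (1 + (c : ℚ) - k) (k - 1)) /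
      (rF 1 (a - j) * rF 1 (k - 1) * rF (1 + (b : ℚ) + c - k) (k - 1)) := by
  obtain ⟨r, rfl⟩ := Nat.exists_eq_add_of_le' hj1
  obtain ⟨n, rfl⟩ := Nat.exists_eq_add_of_le' hj2
  obtain ⟨κ, rfl⟩ := Nat.exists_eq_add_of_le' hk1
  obtain ⟨m, rfl⟩ := Nat.exists_eq_add_of_le' hk2
  simp only [← add_assoc, Nat.add_sub_cancel, Nat.add_sub_add_right]
  have hregion : (Hex (n + r + 1) b (m + κ + 1) \ {(((n + r + 1 : ℕ) : ℤ) + b - (r + 1 : ℕ), 0, true),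
      (((n + r + 1 : ℕ) : ℤ) + b - 1, ((κ + 1 : ℕ) : ℤ) - 1, false)}) =
      Hex (n + r + 1) b (m + κ + 1) \ {((n : ℤ) + b, 0, true), ((n : ℤ) + r + b, (κ : ℤ), false)} := by
    have h1 : ((n + r + 1 : ℕ) : ℤ) + b - (r + 1 : ℕ) = n + b := by push_cast; ring
    have h2 : ((n + r + 1 : ℕ) : ℤ) + b - 1 = n + r + b := by push_cast; ring
    have h3 : ((κ + 1 : ℕ) : ℤ) - 1 = κ := by push_cast; ring
    rw [h1, h2, h3]
  have a1 : -((n + r + 1 : ℕ) : ℚ) + (r + 1 : ℕ) = -n := by push_cast; ring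
  have a2 : -((m + κ + 1 : ℕ) : ℚ) + (κ + 1 : ℕ) = -m := by push_cast; ring
  have a3 : 1 - ((n + r + 1 : ℕ) : ℚ) - (m + κ + 1 : ℕ) = -(n + r + m + κ + 1 : ℕ) := by
    push_cast
    ring
  have a4 : 1 + ((m + κ + 1 : ℕ) : ℚ) - (κ + 1 : ℕ) = m + 1 := by push_cast; ring
  have a5 : 1 + (b : ℚ) + (m + κ + 1 : ℕ) - (κ + 1 : ℕ) = (b + m : ℕ) + 1 := by push_cast; ring
  rw [hregion, M_adjacent_dents, a1, a2, a3, a4, a5, Nat.cast_succ r]
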